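/- arXiv:1005.3845 — 4 statements merged into one kernel-verified Lean document; each statement's English description precedes it below -/
import Mathlib

section
/- Suppose L is an r×r complex matrix satisfying (L − aI)(L* − bI) = 0, where L* is the conjugate-transpose of L, a and b are real numbers, and I is the r×r identity matrix. Then L is Hermitian (L = L*), and every eigenvalue of L equals a or b. -/
open Matrix

/-- If `(x - a)(x - b) = 0` in an algebra over a field, then the spectrum of `x` is contained
in `{a, b}`. -/
theorem eq_or_eq_of_mem_spectrum_of_mul_eq_zero {K A : Type*} [Field K] [Ring A] [Algebra K A]
    {x : A} {a b μ : K} (h : (x - a • (1 : A)) * (x - b • (1 : A)) = 0)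
    (hμ : μ ∈ spectrum K x) : μ = a ∨ μ = b := by
  have : Nontrivial A := by
    by_contra hA
    rw [not_nontrivial_iff_subsingleton] at hA
    simp [spectrum.of_subsingleton] at hμ
  have hmem := spectrum.subset_polynomial_aeval x
    ((Polynomial.X - Polynomial.C a) * (Polynomial.X - Polynomial.C b)) ⟨μ, hμ, rfl⟩
  simpa [Algebra.algebraMap_eq_smul_one, h, sub_eq_zero] using hmem

/-- If an `r×r` complex matrix `L` satisfies `(L − aI)(L* − bI) = 0` with
`a, b` real, then `L` is Hermitian and every eigenvalue of `L` equals `a` or `b`. -/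
theorem hermitian_of_shifted_product_eq_zero {r : ℕ}
    (L : Matrix (Fin r) (Fin r) ℂ) (a b : ℝ)
    (h : (L - (a : ℂ) • (1 : Matrix (Fin r) (Fin r) ℂ)) *
          (Lᴴ - (b : ℂ) • (1 : Matrix (Fin r) (Fin r) ℂ)) = 0) :
    L.IsHermitian ∧ ∀ μ ∈ spectrum ℂ L, μ = (a : ℂ) ∨ μ = (b : ℂ) := by
  have hL : Lᴴ = L := by
    by_cases hab : a = b
    · subst hab
      have hadj : (L - (a : ℂ) • (1 : Matrix (Fin r) (Fin r) ℂ))ᴴ = Lᴴ - (a : ℂ) • 1 := by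
        simp [conjTranspose_smul]
      open scoped ComplexOrder in
      rw [← hadj, self_mul_conjTranspose_eq_zero, sub_eq_zero] at h
      simp [h, conjTranspose_smul]
    · have hadj := congrArg conjTranspose h
      simp only [conjTranspose_mul, conjTranspose_sub, conjTranspose_smul, conjTranspose_one,
        conjTranspose_conjTranspose, conjTranspose_zero, Complex.star_def,
        Complex.conj_ofReal] at hadj
      have hsmul : ((a : ℂ) - b) • (Lᴴ - L) = 0 := by
        have hsub := congrArg₂ (· - ·) hadj h
        simp only [sub_mul, mul_sub, smul_mul_assoc, mul_smul_comm, one_mul, mul_one] at hsub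
        rw [← sub_self (0 : Matrix (Fin r) (Fin r) ℂ), ← hsub]
        module
      exact sub_eq_zero.mp ((smul_eq_zero.mp hsmul).resolve_left
        (sub_ne_zero.mpr (Complex.ofReal_injective.ne hab)))
  rw [hL] at h
  exact ⟨hL, fun μ hμ => eq_or_eq_of_mem_spectrum_of_mul_eq_zero h hμ⟩
end

section
/- Let k ≥ 2 and d ≥ 1 be integers, and let A_1, …, A_k be invertible d×d complex matrices satisfying the ellipticity condition. Then for every integer m ≥ 2, the linear map Δ = −Σ_{i,j=1}^k A_i* A_j ∂_i ∂_j from P_m to P_{m−2} is surjective. -/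
open MvPolynomial Matrix

noncomputable section

abbrev VPoly (k d : ℕ) := Fin d → MvPolynomial (Fin k) ℂ

def IsHomV {k d : ℕ} (m : ℕ) (p : VPoly k d) : Prop := ∀ r, (p r).IsHomogeneous m

def elliptic {k d : ℕ} (A : Fin k → Matrix (Fin d) (Fin d) ℂ) : Prop :=
  ∀ c : Fin k → ℝ, (∑ j, (c j : ℂ) • A j).det = 0 → c = 0

def DeltaOp {k d : ℕ} (A : Fin k → Matrix (Fin d) (Fin d) ℂ) :
    VPoly k d →ₗ[ℂ] VPoly k d :=
  LinearMap.pi fun r =>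
    - ∑ i, ∑ j, ∑ s, ((A i)ᴴ * A j) r s •
        ((pderiv i).toLinearMap ∘ₗ (pderiv j).toLinearMap ∘ₗ LinearMap.proj s)

def BOp {k d : ℕ} (A : Fin k → Matrix (Fin d) (Fin d) ℂ) :
    VPoly k d →ₗ[ℂ] VPoly k d :=
  LinearMap.pi fun r =>
    - ∑ i, ∑ j, ∑ s, ((A i)ᴴ * A j) r s •
        ((LinearMap.mulLeft ℂ (X i * X j)) ∘ₗ LinearMap.proj s)

def LOp {k d : ℕ} (A : Fin k → Matrix (Fin d) (Fin d) ℂ) :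
    VPoly k d →ₗ[ℂ] VPoly k d :=
  LinearMap.pi fun r =>
    (∑ j, ∑ l, ∑ s, ((A l)ᴴ * A j) r s •
        ((LinearMap.mulLeft ℂ (X l)) ∘ₗ (pderiv j).toLinearMap ∘ₗ LinearMap.proj s))
    - ∑ j, (LinearMap.mulLeft ℂ (X j)) ∘ₗ (pderiv j).toLinearMap ∘ₗ LinearMap.proj r

def PmSub (k d m : ℕ) : Submodule ℂ (VPoly k d) :=
  Submodule.pi Set.univ fun _ : Fin d => homogeneousSubmodule (Fin k) ℂ m

def HmSub {k d : ℕ} (A : Fin k → Matrix (Fin d) (Fin d) ℂ) (m : ℕ) :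
    Submodule ℂ (VPoly k d) :=
  PmSub k d m ⊓ LinearMap.ker (DeltaOp A)

def fischer {k d : ℕ} (p q : VPoly k d) : ℂ :=
  ∑ r, ∑ α ∈ (p r).support,
    (∏ i, (Nat.factorial (α i) : ℂ)) * coeff α (p r) * (starRingEnd ℂ) (coeff α (q r))

/-- The power series `∑ ψ(x^α / α!) x^α` representing a linear functional `ψ` on polynomials. -/
def dualSeries (k : ℕ) : (MvPolynomial (Fin k) ℂ →ₗ[ℂ] ℂ) →ₗ[ℂ] MvPowerSeries (Fin k) ℂ where
  toFun ψ := fun α => ψ (monomial α (∏ i, (Nat.factorial (α i) : ℂ))⁻¹)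
  map_add' _ _ := rfl
  map_smul' _ _ := rfl

lemma coeff_dualSeries {k : ℕ} (ψ : MvPolynomial (Fin k) ℂ →ₗ[ℂ] ℂ) (α : Fin k →₀ ℕ) :
    MvPowerSeries.coeff α (dualSeries k ψ) =
      ψ (monomial α (∏ i, (Nat.factorial (α i) : ℂ))⁻¹) := rfl

lemma dualSeries_injective (k : ℕ) : Function.Injective (dualSeries k) := by
  rw [injective_iff_map_eq_zero]
  intro ψ hψ
  refine MvPolynomial.linearMap_ext fun α => LinearMap.ext_ring ?_
  have h := congrArg (MvPowerSeries.coeff α) hψ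
  have hne : (∏ i, (Nat.factorial (α i) : ℂ)) ≠ 0 :=
    Finset.prod_ne_zero_iff.mpr fun i _ => Nat.cast_ne_zero.mpr (Nat.factorial_ne_zero _)
  have hsmul : monomial α (1 : ℂ) =
      (∏ i, (Nat.factorial (α i) : ℂ)) • monomial α (∏ i, (Nat.factorial (α i) : ℂ))⁻¹ := by
    rw [smul_monomial, smul_eq_mul, mul_inv_cancel₀ hne]
  rw [coeff_dualSeries, map_zero] at h
  change ψ (monomial α 1) = 0
  rw [hsmul, map_smul, h, smul_zero]

lemma prod_factorial_add_single {k : ℕ} (β : Fin k →₀ ℕ) (i : Fin k) :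
    (∏ l, (Nat.factorial ((β + Finsupp.single i 1 : Fin k →₀ ℕ) l) : ℂ)) =
      (β i + 1) * ∏ l, (Nat.factorial (β l) : ℂ) := by
  rw [← Finset.mul_prod_erase _ _ (Finset.mem_univ i),
    ← Finset.mul_prod_erase _ (fun l => (Nat.factorial (β l) : ℂ)) (Finset.mem_univ i)]
  have : ∏ l ∈ Finset.univ.erase i, (Nat.factorial ((β + Finsupp.single i 1 : Fin k →₀ ℕ) l) : ℂ) =
      ∏ l ∈ Finset.univ.erase i, (Nat.factorial (β l) : ℂ) := by
    refine Finset.prod_congr rfl fun l hl => ?_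
    simp [Finsupp.single_eq_of_ne (Finset.ne_of_mem_erase hl)]
  rw [this]
  simp [Nat.factorial_succ, mul_assoc]

/-- Precomposition with `∂ᵢ` corresponds to multiplication by `xᵢ` on dual series. -/
lemma dualSeries_comp_pderiv {k : ℕ} (ψ : MvPolynomial (Fin k) ℂ →ₗ[ℂ] ℂ) (i : Fin k) :
    dualSeries k (ψ ∘ₗ (pderiv i).toLinearMap) = MvPowerSeries.X i * dualSeries k ψ := by
  ext α
  rw [coeff_dualSeries, MvPowerSeries.X, MvPowerSeries.coeff_monomial_mul, LinearMap.comp_apply]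
  change ψ (pderiv i _) = _
  rw [pderiv_monomial]
  split_ifs with h
  · obtain ⟨β, rfl⟩ := exists_add_of_le h
    have hne : (β i + 1 : ℂ) ≠ 0 := Nat.cast_add_one_ne_zero _
    rw [add_comm, add_tsub_cancel_right, one_mul, coeff_dualSeries, prod_factorial_add_single]
    congr 2
    simp only [Finsupp.add_apply, Finsupp.single_eq_same, Nat.cast_add, Nat.cast_one]
    rw [_root_.mul_inv_rev, mul_assoc, inv_mul_cancel₀ hne, mul_one]
  · have : α i = 0 := by
      simpa [Finsupp.single_le_iff] using h
    simp [this]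

/-- The polynomial matrix `∑ xᵢ xⱼ Aᵢᴴ Aⱼ`, the symbol of `-Δ`. -/
def symbolMatrix {k d : ℕ} (A : Fin k → Matrix (Fin d) (Fin d) ℂ) :
    Matrix (Fin d) (Fin d) (MvPolynomial (Fin k) ℂ) :=
  Matrix.of fun r s => ∑ i, ∑ j, C (((A i)ᴴ * A j) r s) * (X i * X j)

lemma det_symbolMatrix_ne_zero {k d : ℕ} (A : Fin k → Matrix (Fin d) (Fin d) ℂ) (i₀ : Fin k)
    (hA : IsUnit (A i₀)) : (symbolMatrix A).det ≠ 0 := by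
  intro h
  have h1 := congrArg (MvPolynomial.eval (Pi.single i₀ (1 : ℂ))) h
  rw [RingHom.map_det, map_zero] at h1
  have h2 : (MvPolynomial.eval (Pi.single i₀ (1 : ℂ))).mapMatrix (symbolMatrix A) =
      (A i₀)ᴴ * A i₀ := by
    ext r s
    simp [symbolMatrix, Pi.single_apply]
  rw [h2, Matrix.det_mul, Matrix.det_conjTranspose] at h1
  have h3 := ((Matrix.isUnit_iff_isUnit_det _).mp hA).ne_zero
  simp [h3] at h1

lemma DeltaOp_apply {k d : ℕ} (A : Fin k → Matrix (Fin d) (Fin d) ℂ) (p : VPoly k d)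
    (r : Fin d) : DeltaOp A p r =
      -∑ i, ∑ j, ∑ s, ((A i)ᴴ * A j) r s • pderiv i (pderiv j (p s)) := by
  simp [DeltaOp, LinearMap.sum_apply]

lemma range_DeltaOp_eq_top {k d : ℕ} (A : Fin k → Matrix (Fin d) (Fin d) ℂ)
    (i₀ : Fin k) (hA : IsUnit (A i₀)) : LinearMap.range (DeltaOp A) = ⊤ := by
  by_contra hne
  obtain ⟨φ, hφ, hle⟩ := Submodule.exists_le_ker_of_lt_top _ (lt_top_iff_ne_top.mpr hne)
  refine hφ ?_
  let ψ : Fin d → MvPolynomial (Fin k) ℂ →ₗ[ℂ] ℂ := fun r =>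
    φ ∘ₗ LinearMap.single ℂ (fun _ : Fin d => MvPolynomial (Fin k) ℂ) r
  have hφψ (p : VPoly k d) : φ p = ∑ r, ψ r (p r) := by
    conv_lhs => rw [← Finset.univ_sum_single p]
    simp [ψ]
  have hrel (s : Fin d) : ∑ r, ∑ i, ∑ j, ((A i)ᴴ * A j) r s •
      (ψ r ∘ₗ (pderiv i).toLinearMap ∘ₗ (pderiv j).toLinearMap) = 0 := by
    refine LinearMap.ext fun f => ?_
    have h : φ (DeltaOp A (Pi.single s f)) = 0 := hle ⟨_, rfl⟩
    have happ (r : Fin d) : DeltaOp A (Pi.single s f) r =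
        -∑ i, ∑ j, ((A i)ᴴ * A j) r s • pderiv i (pderiv j f) := by
      rw [DeltaOp_apply]
      refine congrArg Neg.neg (Finset.sum_congr rfl fun i _ => Finset.sum_congr rfl fun j _ => ?_)
      rw [Finset.sum_eq_single s]
      · simp
      · intro t _ hts
        simp [Pi.single_eq_of_ne hts]
      · simp
    rw [hφψ] at h
    simp only [happ, map_neg, map_sum, map_smul, Finset.sum_neg_distrib, neg_eq_zero] at h
    simpa [LinearMap.sum_apply] using h
  let ι : MvPolynomial (Fin k) ℂ →+* MvPowerSeries (Fin k) ℂ := coeToMvPowerSeries.ringHom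
  have hdet : (ι.mapMatrix (symbolMatrix A)).det ≠ 0 := by
    rw [← RingHom.map_det]
    exact (map_ne_zero_iff ι (MvPolynomial.coe_injective _ _)).mpr (det_symbolMatrix_ne_zero A i₀ hA)
  have hvec : (fun r => dualSeries k (ψ r)) ᵥ* ι.mapMatrix (symbolMatrix A) = 0 := by
    ext1 s
    have h := congrArg (dualSeries k) (hrel s)
    simp only [map_sum, map_smul, map_zero, ← LinearMap.comp_assoc, dualSeries_comp_pderiv] at h
    rw [Pi.zero_apply, ← h]
    simp only [Matrix.vecMul, dotProduct, RingHom.mapMatrix_apply, Matrix.map_apply, symbolMatrix,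
      Matrix.of_apply, map_sum, map_mul, Finset.mul_sum]
    refine Finset.sum_congr rfl fun r _ => Finset.sum_congr rfl fun i _ =>
      Finset.sum_congr rfl fun j _ => ?_
    simp only [ι, coeToMvPowerSeries.ringHom_apply, coe_C, coe_X, MvPowerSeries.smul_eq_C_mul]
    ring
  have hzero := Matrix.eq_zero_of_vecMul_eq_zero hdet hvec
  refine LinearMap.ext fun p => ?_
  rw [hφψ]
  refine Finset.sum_eq_zero fun r _ => ?_
  have : ψ r = 0 := dualSeries_injective k ((congrFun hzero r).trans (map_zero _).symm)
  rw [this, LinearMap.zero_apply]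

lemma pderiv_homogeneousComponent_succ {k : ℕ} (i : Fin k) (n : ℕ)
    (f : MvPolynomial (Fin k) ℂ) :
    pderiv i (homogeneousComponent (n + 1) f) = homogeneousComponent n (pderiv i f) := by
  ext α
  simp [coeff_pderiv, coeff_homogeneousComponent]

lemma DeltaOp_homogeneousComponent {k d : ℕ} (A : Fin k → Matrix (Fin d) (Fin d) ℂ)
    (n : ℕ) (p : VPoly k d) (r : Fin d) :
    DeltaOp A (fun s => homogeneousComponent (n + 2) (p s)) r =
      homogeneousComponent n (DeltaOp A p r) := by
  simp [DeltaOp_apply, pderiv_homogeneousComponent_succ]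

/-- For `k ≥ 2`, `d ≥ 1` and invertible matrices `A 1, …, A k` satisfying the
ellipticity condition, for every `m ≥ 2` the operator `Δ = −Σ Aᵢᴴ Aⱼ ∂ᵢ∂ⱼ` maps the space of
`ℂ^d`-valued homogeneous polynomials of degree `m` **onto** those of degree `m − 2`. -/
theorem deltaOp_surjective (k d : ℕ) (hk : 2 ≤ k) (hd : 1 ≤ d)
    (A : Fin k → Matrix (Fin d) (Fin d) ℂ)
    (hinv : ∀ j, IsUnit (A j))
    (hell : elliptic A)
    (m : ℕ) (hm : 2 ≤ m)
    (q : VPoly k d) (hq : IsHomV (m - 2) q) :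
    ∃ p : VPoly k d, IsHomV m p ∧ DeltaOp A p = q := by
  obtain ⟨n, rfl⟩ := Nat.exists_eq_add_of_le' hm
  have hi₀ : 0 < k := by omega
  obtain ⟨p, hp⟩ := LinearMap.range_eq_top.mp
    (range_DeltaOp_eq_top A ⟨0, hi₀⟩ (hinv _)) q
  refine ⟨fun s => homogeneousComponent (n + 2) (p s),
    fun s => homogeneousComponent_isHomogeneous _ _, funext fun r => ?_⟩
  rw [DeltaOp_homogeneousComponent, hp]
  exact homogeneousComponent_eq_self (hq r)

end
end

section
/- Let k ≥ 2 and d ≥ 1 be integers, let A_1, …, A_k be invertible d×d complex matrices satisfying the ellipticity condition, and assume that Σ_{j=1}^k θ_j A_j is a unitary matrix for every unit vector θ ∈ S^{k−1}. Then for every integer m ≥ 0, every eigenvalue of the operator L restricted to P_m lies in the set {−m, −m+1, …, −1, 0} ∪ {k−1, k, …, m+k−2}; in particular no eigenvalue of L on any P_m lies strictly between 0 and k−1. -/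
open MvPolynomial Matrix

noncomputable section

/-- Intertwining relation `D L = (k - 1 - L') D` in an abstract algebra generated by two families
satisfying Clifford type relations, coordinates and derivations. -/
theorem dirac_mul_spherical {R ι : Type*} [Ring R] [Fintype ι] [DecidableEq ι]
    (a b x D : ι → R)
    (hab : ∀ i j, a i * b j + a j * b i = if i = j then 2 else 0) (hab1 : ∀ i, a i * b i = 1)
    (hxa : ∀ i j, Commute (x i) (a j))
    (hDa : ∀ i j, Commute (D i) (a j)) (hDb : ∀ i j, Commute (D i) (b j))
    (hD : ∀ i j, Commute (D i) (D j))
    (hDx : ∀ i j, D i * x j = x j * D i + if i = j then 1 else 0) :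
    (∑ i, a i * D i) * ((∑ j, ∑ l, x l * (b l * a j) * D j) - ∑ j, x j * D j) =
      ((Fintype.card ι : R) - 1 - ((∑ j, ∑ l, x l * (a l * b j) * D j) - ∑ j, x j * D j)) *
        ∑ i, a i * D i := by
  have hfactor : ∑ j, ∑ l, x l * (b l * a j) * D j = (∑ l, x l * b l) * ∑ j, a j * D j := by
    rw [Finset.sum_mul_sum, Finset.sum_comm]
    simp only [mul_assoc]
  have hDX : (∑ i, a i * D i) * (∑ l, x l * b l) =
      (Fintype.card ι : R) + 2 * (∑ j, x j * D j) - ∑ j, ∑ l, x l * (a l * b j) * D j := by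
    have hterm : ∀ i l, a i * D i * (x l * b l) =
        (if i = l then 1 else 0) + (if i = l then 2 * (x l * D i) else 0)
          - x l * (a l * b i) * D i := by
      intro i l
      have h1 : a i * D i * (x l * b l) =
          x l * (a i * b l) * D i + if i = l then a i * b l else 0 := by
        calc a i * D i * (x l * b l) = a i * (D i * x l) * b l := by simp only [mul_assoc]
          _ = a i * x l * (D i * b l) + a i * (if i = l then 1 else 0) * b l := by
            rw [hDx]; simp only [mul_add, add_mul, mul_assoc]
          _ = _ := by
            rw [(hDb i l).eq, ← (hxa l i).eq]
            split_ifs <;> simp [mul_assoc]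
      rw [h1, eq_sub_of_add_eq (hab i l)]
      split_ifs with h
      · subst h
        have h2 : (2 : R) - 1 = 1 := by norm_num
        rw [hab1, h2]
        noncomm_ring
      · noncomm_ring
    rw [Finset.sum_mul_sum, Finset.mul_sum]
    simp [hterm, Finset.sum_sub_distrib, Finset.sum_add_distrib]
  have hDE : (∑ i, a i * D i) * (∑ j, x j * D j) =
      (∑ j, x j * D j) * (∑ i, a i * D i) + ∑ i, a i * D i := by
    have hterm : ∀ i j, a i * D i * (x j * D j) =
        x j * D j * (a i * D i) + if i = j then a i * D i else 0 := by
      intro i j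
      calc a i * D i * (x j * D j) = a i * (D i * x j) * D j := by simp only [mul_assoc]
        _ = a i * x j * (D i * D j) + a i * (if i = j then 1 else 0) * D j := by
          rw [hDx]; simp only [mul_add, add_mul, mul_assoc]
        _ = x j * (a i * D j) * D i + if i = j then a i * D i else 0 := by
          rw [(hD i j).eq, ← (hxa j i).eq]
          split_ifs with h
          · subst h; simp [mul_assoc]
          · simp [mul_assoc]
        _ = _ := by rw [← (hDa j i).eq]; simp only [mul_assoc]
    simp only [Finset.sum_mul_sum, hterm, Finset.sum_add_distrib,
      Finset.sum_ite_eq, Finset.mem_univ, if_true]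
    rw [Finset.sum_comm]
  rw [mul_sub, hfactor, ← mul_assoc, hDX, hDE]
  noncomm_ring

/-- Action of a constant matrix on vector-valued polynomials. -/
def matrixAct {k d : ℕ} (B : Matrix (Fin d) (Fin d) ℂ) : VPoly k d →ₗ[ℂ] VPoly k d :=
  LinearMap.pi fun r => ∑ s, B r s • LinearMap.proj s

/-- Componentwise multiplication by a coordinate. -/
def coordMul {k d : ℕ} (j : Fin k) : VPoly k d →ₗ[ℂ] VPoly k d :=
  (LinearMap.mulLeft ℂ (X j)).compLeft (Fin d)

/-- Componentwise partial derivative. -/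
def vecPderiv {k d : ℕ} (j : Fin k) : VPoly k d →ₗ[ℂ] VPoly k d :=
  (pderiv j).toLinearMap.compLeft (Fin d)

/-- The Dirac type operator `∑ j, A j ∂_j`. -/
def diracOp {k d : ℕ} (A : Fin k → Matrix (Fin d) (Fin d) ℂ) : VPoly k d →ₗ[ℂ] VPoly k d :=
  ∑ j, matrixAct (A j) * vecPderiv j

section

variable {k d : ℕ}

@[simp] theorem matrixAct_apply (B : Matrix (Fin d) (Fin d) ℂ) (p : VPoly k d) (r : Fin d) :
    matrixAct B p r = ∑ s, B r s • p s := by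
  simp [matrixAct]

@[simp] theorem coordMul_apply (j : Fin k) (p : VPoly k d) (r : Fin d) :
    coordMul j p r = X j * p r := rfl

@[simp] theorem vecPderiv_apply (j : Fin k) (p : VPoly k d) (r : Fin d) :
    vecPderiv j p r = pderiv j (p r) := rfl

theorem matrixAct_one : (matrixAct 1 : VPoly k d →ₗ[ℂ] VPoly k d) = 1 := by
  refine LinearMap.ext fun p => funext fun r => ?_
  simp [Matrix.one_apply, ite_smul]

theorem matrixAct_add (B C : Matrix (Fin d) (Fin d) ℂ) :
    (matrixAct (B + C) : VPoly k d →ₗ[ℂ] VPoly k d) = matrixAct B + matrixAct C := by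
  refine LinearMap.ext fun p => funext fun r => ?_
  simp [add_smul, Finset.sum_add_distrib]

theorem matrixAct_mul (B C : Matrix (Fin d) (Fin d) ℂ) :
    (matrixAct (B * C) : VPoly k d →ₗ[ℂ] VPoly k d) = matrixAct B * matrixAct C := by
  refine LinearMap.ext fun p => funext fun r => ?_
  simp only [matrixAct_apply, Module.End.mul_apply, Matrix.mul_apply, Finset.sum_smul,
    Finset.smul_sum, smul_smul]
  exact Finset.sum_comm

theorem commute_coordMul_matrixAct (j : Fin k) (B : Matrix (Fin d) (Fin d) ℂ) :
    Commute (coordMul j) (matrixAct B) := by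
  refine LinearMap.ext fun p => funext fun r => ?_
  simp [Finset.mul_sum]

theorem commute_vecPderiv_matrixAct (j : Fin k) (B : Matrix (Fin d) (Fin d) ℂ) :
    Commute (vecPderiv j) (matrixAct B) := by
  refine LinearMap.ext fun p => funext fun r => ?_
  simp

theorem commute_vecPderiv (i j : Fin k) :
    Commute (vecPderiv i : VPoly k d →ₗ[ℂ] VPoly k d) (vecPderiv j) := by
  refine LinearMap.ext fun p => funext fun r => ?_
  let δ (l : Fin k) : Derivation ℂ (MvPolynomial (Fin k) ℂ) (MvPolynomial (Fin k) ℂ) := pderiv l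
  have h : ⁅δ i, δ j⁆ = 0 := by
    refine MvPolynomial.derivation_ext fun l => ?_
    simp [δ, Derivation.commutator_apply, pderiv_X, Pi.single_apply, apply_ite]
  have h' := DFunLike.congr_fun h (p r)
  rw [Derivation.commutator_apply] at h'
  exact sub_eq_zero.mp h'

theorem vecPderiv_mul_coordMul (i j : Fin k) :
    (vecPderiv i * coordMul j : VPoly k d →ₗ[ℂ] VPoly k d) =
      coordMul j * vecPderiv i + if i = j then 1 else 0 := by
  refine LinearMap.ext fun p => funext fun r => ?_
  rcases eq_or_ne i j with rfl | h
  · simp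
  · simp [h, pderiv_X_of_ne h.symm]

theorem LOp_eq (A : Fin k → Matrix (Fin d) (Fin d) ℂ) :
    LOp A = (∑ j, ∑ l, coordMul l * (matrixAct (A l)ᴴ * matrixAct (A j)) * vecPderiv j)
      - ∑ j, coordMul j * vecPderiv j := by
  simp only [← matrixAct_mul]
  refine LinearMap.ext fun p => funext fun r => ?_
  simp [LOp, Finset.mul_sum, LinearMap.sum_apply]

theorem LOp_eq_diracOp (A : Fin k → Matrix (Fin d) (Fin d) ℂ) :
    LOp A = (∑ l, coordMul l * matrixAct (A l)ᴴ) * diracOp A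
      - ∑ j, coordMul j * vecPderiv j := by
  rw [LOp_eq, diracOp, Finset.sum_mul_sum, Finset.sum_comm]
  simp only [mul_assoc]

theorem euler_apply {m : ℕ} {p : VPoly k d} (hp : IsHomV m p) :
    (∑ j, coordMul j * vecPderiv j : VPoly k d →ₗ[ℂ] VPoly k d) p = (m : ℂ) • p := by
  refine funext fun r => ?_
  have h := (hp r).sum_X_mul_pderiv
  simpa [LinearMap.sum_apply, Nat.cast_smul_eq_nsmul] using h

theorem diracOp_isHomV (A : Fin k → Matrix (Fin d) (Fin d) ℂ) {m : ℕ} {p : VPoly k d}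
    (hp : IsHomV m p) : IsHomV (m - 1) (diracOp A p) := by
  intro r
  simp only [diracOp, LinearMap.sum_apply, Finset.sum_apply, Module.End.mul_apply,
    matrixAct_apply, vecPderiv_apply]
  refine IsHomogeneous.sum _ _ _ fun j _ => IsHomogeneous.sum _ _ _ fun s _ => ?_
  rw [smul_eq_C_mul]
  simpa using (isHomogeneous_C (Fin k) (A j r s)).mul (hp s).pderiv

theorem diracOp_mul_LOp (A : Fin k → Matrix (Fin d) (Fin d) ℂ)
    (h1 : ∀ i, A i * (A i)ᴴ = 1) (h2 : ∀ i j, i ≠ j → A i * (A j)ᴴ + A j * (A i)ᴴ = 0) :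
    diracOp A * LOp A =
      ((k : VPoly k d →ₗ[ℂ] VPoly k d) - 1 - LOp fun j => (A j)ᴴ) * diracOp A := by
  have hone : ∀ i, (matrixAct (A i) * matrixAct (A i)ᴴ : VPoly k d →ₗ[ℂ] VPoly k d) = 1 :=
    fun i => by rw [← matrixAct_mul, h1, matrixAct_one]
  have h := dirac_mul_spherical (R := Module.End ℂ (VPoly k d)) (fun j => matrixAct (A j))
    (fun j => matrixAct (A j)ᴴ) coordMul vecPderiv
    (fun i j => by
      rcases eq_or_ne i j with rfl | hij
      · simp only [hone, if_true, one_add_one_eq_two]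
      · have hzero : (matrixAct 0 : VPoly k d →ₗ[ℂ] VPoly k d) = 0 :=
          LinearMap.ext fun p => funext fun r => by simp
        rw [if_neg hij, ← matrixAct_mul, ← matrixAct_mul, ← matrixAct_add, h2 i j hij, hzero])
    hone (fun _ _ => commute_coordMul_matrixAct _ _)
    (fun _ _ => commute_vecPderiv_matrixAct _ _) (fun _ _ => commute_vecPderiv_matrixAct _ _)
    commute_vecPderiv vecPderiv_mul_coordMul
  rw [LOp_eq, LOp_eq]
  simpa [diracOp] using h

/-- Eigenvalues of `L` under the Clifford relations, by induction on the degree: the operator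
`∑ j, A j ∂_j` sends a `μ`-eigenvector of `L` to a `(k - 1 - μ)`-eigenvector of the operator
attached to the adjoint matrices. -/
theorem eigenvalue_of_clifford (m : ℕ) : ∀ (A : Fin k → Matrix (Fin d) (Fin d) ℂ),
    (∀ i, A i * (A i)ᴴ = 1) → (∀ i, (A i)ᴴ * A i = 1) →
    (∀ i j, i ≠ j → A i * (A j)ᴴ + A j * (A i)ᴴ = 0) →
    (∀ i j, i ≠ j → (A i)ᴴ * A j + (A j)ᴴ * A i = 0) →
    ∀ (p : VPoly k d) (μ : ℂ), IsHomV m p → p ≠ 0 → LOp A p = μ • p →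
    (∃ n : ℕ, n ≤ m ∧ μ = -(n : ℂ)) ∨ (∃ n : ℕ, n < m ∧ μ = (k : ℂ) - 1 + n) := by
  induction m with
  | zero =>
    intro A _ _ _ _ p μ hp hp0 heig
    have hconst : ∀ j, vecPderiv j p = 0 := fun j => funext fun r => by
      have h := (totalDegree_zero_iff_isHomogeneous (Fin k)).2 (hp r)
      rw [totalDegree_eq_zero_iff_eq_C] at h
      rw [vecPderiv_apply, h, pderiv_C]
      rfl
    have h0 : LOp A p = 0 := by
      simp [LOp_eq, LinearMap.sum_apply, hconst]
    rw [h0] at heig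
    exact .inl ⟨0, le_rfl, by simpa [hp0] using heig.symm⟩
  | succ m ih =>
    intro A h1 h1' h2 h2' p μ hp hp0 heig
    by_cases hq : diracOp A p = 0
    · have h : -((m + 1 : ℕ) : ℂ) • p = μ • p := by
        rw [← heig, LOp_eq_diracOp, LinearMap.sub_apply, Module.End.mul_apply, hq, map_zero,
          euler_apply hp, zero_sub, neg_smul]
      exact .inl ⟨m + 1, le_rfl, (smul_left_injective ℂ hp0 h).symm⟩
    · have h := LinearMap.congr_fun (diracOp_mul_LOp A h1 h2) p
      have hL : LOp (fun j => (A j)ᴴ) (diracOp A p) = ((k : ℂ) - 1 - μ) • diracOp A p := by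
        simp only [Module.End.mul_apply, heig, map_smul, LinearMap.sub_apply,
          Module.End.one_apply, Module.End.natCast_apply] at h
        rw [sub_smul, sub_smul, one_smul, Nat.cast_smul_eq_nsmul, h, sub_sub_cancel]
      have hh := ih (fun j => (A j)ᴴ) (by simpa using h1') (by simpa using h1)
        (by simpa using h2') (by simpa using h2) _ _ (diracOp_isHomV A hp) hq hL
      rcases hh with ⟨n, hn, e⟩ | ⟨n, hn, e⟩
      · exact .inr ⟨n, by omega, by linear_combination -e⟩
      · exact .inl ⟨n, by omega, by linear_combination -e⟩

end

theorem mul_conjTranspose_add_of_unitary {d : ℕ} {U V : Matrix (Fin d) (Fin d) ℂ}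
    (hU : U * Uᴴ = 1) (hV : V * Vᴴ = 1)
    (h : ((3 / 5 : ℂ) • U + (4 / 5 : ℂ) • V) * ((3 / 5 : ℂ) • U + (4 / 5 : ℂ) • V)ᴴ = 1) :
    U * Vᴴ + V * Uᴴ = 0 := by
  have e : ((3 / 5 : ℂ) • U + (4 / 5 : ℂ) • V) * ((3 / 5 : ℂ) • U + (4 / 5 : ℂ) • V)ᴴ =
      (9 / 25 : ℂ) • (U * Uᴴ) + (16 / 25 : ℂ) • (V * Vᴴ) + (12 / 25 : ℂ) • (U * Vᴴ + V * Uᴴ) := by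
    simp only [conjTranspose_add, conjTranspose_smul, add_mul, mul_add, smul_mul_assoc,
      mul_smul_comm, smul_smul, smul_add]
    norm_num
    module
  rw [e, hU, hV, ← add_smul, show (9 / 25 + 16 / 25 : ℂ) = 1 by norm_num, one_smul,
    add_eq_left] at h
  exact (smul_eq_zero.1 h).resolve_left (by norm_num)

/-- Every eigenvalue of `L` on `P_m` lies in
`{−m, …, −1, 0} ∪ {k−1, k, …, m+k−2}`; in particular no eigenvalue lies strictly between `0`
and `k−1`. -/
theorem eigenvalues_of_spherical_operator (k d : ℕ) (hk : 2 ≤ k) (hd : 1 ≤ d)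
    (A : Fin k → Matrix (Fin d) (Fin d) ℂ)
    (hinv : ∀ j, IsUnit (A j))
    (hell : elliptic A)
    (hunit : ∀ θ : Fin k → ℝ, (∑ j, θ j ^ 2) = 1 →
      (∑ j, (θ j : ℂ) • A j) ∈ Matrix.unitaryGroup (Fin d) ℂ)
    (m : ℕ) (p : VPoly k d) (μ : ℂ)
    (hp : IsHomV m p) (hp0 : p ≠ 0) (heig : LOp A p = μ • p) :
    ((∃ n : ℕ, n ≤ m ∧ μ = -(n : ℂ)) ∨
      (∃ n : ℕ, k - 1 ≤ n ∧ n ≤ m + k - 2 ∧ μ = (n : ℂ))) ∧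
    (∀ x : ℝ, μ = (x : ℂ) → ¬ (0 < x ∧ x < (k : ℝ) - 1)) := by
  have hone : ∀ j, A j ∈ Matrix.unitaryGroup (Fin d) ℂ := fun j => by
    have h := hunit (Pi.single j 1) (by simp [Pi.single_apply])
    simpa [Pi.single_apply, ite_smul] using h
  have htwo : ∀ i j, i ≠ j →
      (3 / 5 : ℂ) • A i + (4 / 5 : ℂ) • A j ∈ Matrix.unitaryGroup (Fin d) ℂ := fun i j hij => by
    have h := hunit (Pi.single i (3 / 5) + Pi.single j (4 / 5)) (by
      rw [Fintype.sum_eq_add i j hij (fun l hl => by simp [hl.1, hl.2])]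
      simp [hij, hij.symm]
      norm_num)
    rw [Fintype.sum_eq_add i j hij (fun l hl => by simp [hl.1, hl.2])] at h
    simpa [hij, hij.symm] using h
  have h1 : ∀ i, A i * (A i)ᴴ = 1 := fun i => Matrix.mem_unitaryGroup_iff.1 (hone i)
  have h1' : ∀ i, (A i)ᴴ * A i = 1 := fun i => Matrix.mem_unitaryGroup_iff'.1 (hone i)
  have hcases := eigenvalue_of_clifford m A h1 h1'
    (fun i j hij => mul_conjTranspose_add_of_unitary (h1 i) (h1 j)
      (Matrix.mem_unitaryGroup_iff.1 (htwo i j hij)))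
    (fun i j hij => by
      have h := mul_conjTranspose_add_of_unitary (U := (A i)ᴴ) (V := (A j)ᴴ)
        (by simpa using h1' i) (by simpa using h1' j)
        (by simpa [conjTranspose_add, conjTranspose_smul, star_eq_conjTranspose] using
          Matrix.mem_unitaryGroup_iff'.1 (htwo i j hij))
      simpa using h)
    p μ hp hp0 heig
  constructor
  · refine hcases.imp_right ?_
    rintro ⟨n, hn, e⟩
    refine ⟨k - 1 + n, by omega, by omega, ?_⟩
    rw [e, Nat.cast_add, Nat.cast_sub (by omega), Nat.cast_one]
  · rintro x rfl ⟨hx0, hxk⟩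
    rcases hcases with ⟨n, -, e⟩ | ⟨n, -, e⟩
    · have e' : x = -(n : ℝ) := by exact_mod_cast e
      linarith [n.cast_nonneg (α := ℝ)]
    · have e' : x = (k : ℝ) - 1 + n := by exact_mod_cast e
      linarith [n.cast_nonneg (α := ℝ)]

end
end

section
/- Let k ≥ 2 and d ≥ 1 be integers, let A_1, …, A_k be invertible d×d complex matrices satisfying the ellipticity condition, and assume that Σ_{j=1}^k θ_j A_j is a unitary matrix for every unit vector θ ∈ S^{k−1}. Then for every integer j ≥ 0, the eigenspace of L for the eigenvalue −j acting on P_j and the eigenspace of L for the eigenvalue j+k−1 acting on P_{j+1} have the same dimension, and this common dimension equals d·binom(j+k−2, j); that is, dim ker(L + j·id_{P_j}) = dim ker(L − (j+k−1)·id_{P_{j+1}}) = d·binom(j+k−2, j). -/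
open MvPolynomial Matrix

noncomputable section

/-- The eigenspace of `L` for the eigenvalue `μ`, within the space `P_m` of `ℂ^d`-valued
homogeneous polynomials of degree `m`. -/
def eigenSub {k d : ℕ} (A : Fin k → Matrix (Fin d) (Fin d) ℂ) (m : ℕ) (μ : ℂ) :
    Submodule ℂ (VPoly k d) :=
  PmSub k d m ⊓ LinearMap.ker (LOp A - μ • (LinearMap.id : VPoly k d →ₗ[ℂ] VPoly k d))

namespace MvPolynomial

theorem finrank_homogeneousSubmodule (k m : ℕ) :
    Module.finrank ℂ (homogeneousSubmodule (Fin k) ℂ m) = (k + m - 1).choose m := by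
  classical
  rw [homogeneousSubmodule_eq_finsupp_supported,
    (AddMonoidAlgebra.supportedEquivFinsupp (R := ℂ) (S := ℂ)
      {d : Fin k →₀ ℕ | d.degree = m}).finrank_eq]
  have hs : {d : Fin k →₀ ℕ | d.degree = m} =
      ((Finset.univ : Finset (Fin k)).finsuppAntidiag m : Set (Fin k →₀ ℕ)) := by
    ext f
    simp [Finsupp.degree_eq_sum]
  rw [hs, Module.finrank_finsupp_self]
  have := Finset.card_finsuppAntidiag_nat_eq_choose (s := (Finset.univ : Finset (Fin k))) m
  simpa using this

end MvPolynomial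

namespace VPoly

variable {k d : ℕ}

theorem mem_PmSub {m : ℕ} {p : VPoly k d} :
    p ∈ PmSub k d m ↔ ∀ r, (p r).IsHomogeneous m := by
  simp [PmSub, Submodule.mem_pi, mem_homogeneousSubmodule]

/-- `P_m` is the `d`-fold power of the space of scalar homogeneous polynomials. -/
def pmSubEquiv (k d m : ℕ) :
    PmSub k d m ≃ₗ[ℂ] (Fin d → homogeneousSubmodule (Fin k) ℂ m) where
  toFun p r := ⟨p.1 r, mem_PmSub.1 p.2 r⟩
  invFun q := ⟨fun r => (q r).1, mem_PmSub.2 fun r => (q r).2⟩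
  map_add' _ _ := rfl
  map_smul' _ _ := rfl
  left_inv _ := rfl
  right_inv _ := rfl

instance finiteDimensional_homogeneousSubmodule (k m : ℕ) :
    FiniteDimensional ℂ (homogeneousSubmodule (Fin k) ℂ m) :=
  Module.Finite.iff_fg.2 (homogeneousSubmodule_fg (Fin k) ℂ m)

instance finiteDimensional_PmSub (k d m : ℕ) : FiniteDimensional ℂ (PmSub k d m) :=
  Module.Finite.equiv (pmSubEquiv k d m).symm

theorem finrank_PmSub (k d m : ℕ) :
    Module.finrank ℂ (PmSub k d m) = d * (k + m - 1).choose m := by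
  rw [(pmSubEquiv k d m).finrank_eq, Module.finrank_pi_fintype]
  simp [finrank_homogeneousSubmodule]

/-- A constant matrix acting on vector-valued polynomials. -/
def act (B : Matrix (Fin d) (Fin d) ℂ) : VPoly k d →ₗ[MvPolynomial (Fin k) ℂ] VPoly k d :=
  (B.map C).mulVecLin

theorem act_apply (B : Matrix (Fin d) (Fin d) ℂ) (p : VPoly k d) (r : Fin d) :
    act B p r = ∑ s, B r s • p s := by
  simp [act, Matrix.mulVec, dotProduct, smul_eq_C_mul]

theorem act_act (B B' : Matrix (Fin d) (Fin d) ℂ) (p : VPoly k d) :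
    act B (act B' p) = act (B * B') p := by
  simp [act, Matrix.mulVec_mulVec, Matrix.map_mul]

theorem act_add (B B' : Matrix (Fin d) (Fin d) ℂ) (p : VPoly k d) :
    act (B + B') p = act B p + act B' p := by
  ext1 r; simp [act_apply, add_smul, Finset.sum_add_distrib]

theorem act_smul (c : ℂ) (B : Matrix (Fin d) (Fin d) ℂ) (p : VPoly k d) :
    act (c • B) p = c • act B p := by
  ext1 r; simp [act_apply, mul_smul, Finset.smul_sum]

theorem act_one (p : VPoly k d) : act 1 p = p := by
  simp [act, Matrix.map_one C (map_zero C) (map_one C)]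

theorem act_mem_PmSub {m : ℕ} (B : Matrix (Fin d) (Fin d) ℂ) {p : VPoly k d}
    (hp : p ∈ PmSub k d m) : act B p ∈ PmSub k d m := by
  rw [mem_PmSub] at hp ⊢
  intro r
  rw [act_apply]
  exact Submodule.sum_mem (homogeneousSubmodule (Fin k) ℂ m) fun s _ =>
    Submodule.smul_mem _ _ (hp s)

/-- The componentwise partial derivative. -/
def pd (i : Fin k) : VPoly k d →ₗ[ℂ] VPoly k d :=
  (pderiv i).toLinearMap.compLeft (Fin d)

@[simp]
theorem pd_apply (i : Fin k) (p : VPoly k d) (r : Fin d) : pd i p r = pderiv i (p r) := rfl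

theorem pd_act (i : Fin k) (B : Matrix (Fin d) (Fin d) ℂ) (p : VPoly k d) :
    pd i (act B p) = act B (pd i p) := by
  ext1 r; simp [act_apply]

theorem pd_X_smul (i l : Fin k) (p : VPoly k d) :
    pd i ((X l : MvPolynomial (Fin k) ℂ) • p) =
      (if i = l then p else 0) + (X l : MvPolynomial (Fin k) ℂ) • pd i p := by
  ext1 r
  by_cases h : i = l
  · subst h; simp [add_comm]
  · simp [h, pderiv_X_of_ne (Ne.symm h)]

/-- The first-order operator `∑ B_i ∂_i`. -/
def dirac (B : Fin k → Matrix (Fin d) (Fin d) ℂ) : VPoly k d →ₗ[ℂ] VPoly k d :=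
  ∑ i, (act (B i)).restrictScalars ℂ ∘ₗ pd i

theorem dirac_apply (B : Fin k → Matrix (Fin d) (Fin d) ℂ) (p : VPoly k d) :
    dirac B p = ∑ i, act (B i) (pd i p) := by
  simp [dirac]

/-- The multiplication operator `∑ x_i B_i`. -/
def symb (B : Fin k → Matrix (Fin d) (Fin d) ℂ) :
    VPoly k d →ₗ[MvPolynomial (Fin k) ℂ] VPoly k d :=
  ∑ i, (X i : MvPolynomial (Fin k) ℂ) • act (B i)

theorem symb_apply (B : Fin k → Matrix (Fin d) (Fin d) ℂ) (p : VPoly k d) :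
    symb B p = ∑ i, (X i : MvPolynomial (Fin k) ℂ) • act (B i) p := by
  simp [symb]

theorem dirac_mem_PmSub {m : ℕ} (B : Fin k → Matrix (Fin d) (Fin d) ℂ) {p : VPoly k d}
    (hp : p ∈ PmSub k d m) : dirac B p ∈ PmSub k d (m - 1) := by
  rw [dirac_apply]
  refine Submodule.sum_mem _ fun i _ => act_mem_PmSub _ ?_
  rw [mem_PmSub] at hp ⊢
  exact fun r => (hp r).pderiv

theorem symb_mem_PmSub {m : ℕ} (B : Fin k → Matrix (Fin d) (Fin d) ℂ) {p : VPoly k d}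
    (hp : p ∈ PmSub k d m) : symb B p ∈ PmSub k d (m + 1) := by
  rw [symb_apply]
  refine Submodule.sum_mem _ fun i _ => ?_
  have h := mem_PmSub.1 (act_mem_PmSub (B i) hp)
  rw [mem_PmSub]
  intro r
  rw [add_comm]
  exact (isHomogeneous_X ℂ i).mul (h r)

theorem euler_apply {m : ℕ} {p : VPoly k d} (hp : p ∈ PmSub k d m) :
    ∑ i, (X i : MvPolynomial (Fin k) ℂ) • pd i p = (m : ℂ) • p := by
  ext1 r
  simpa [Finset.sum_apply, Nat.cast_smul_eq_nsmul] using (mem_PmSub.1 hp r).sum_X_mul_pderiv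

theorem LOp_apply {m : ℕ} (A : Fin k → Matrix (Fin d) (Fin d) ℂ) {p : VPoly k d}
    (hp : p ∈ PmSub k d m) :
    LOp A p = symb (fun i => (A i)ᴴ) (dirac A p) - (m : ℂ) • p := by
  rw [← euler_apply hp, symb_apply]
  simp only [dirac_apply, map_sum, act_act, Finset.smul_sum]
  rw [Finset.sum_comm]
  ext1 r
  simp [LOp, act_apply, Finset.sum_apply, Finset.mul_sum]

/-- The polarised form of `(∑ θ_i B_i) (∑ θ_i B'_i) = |θ|²`. -/
def IsCliffordPair (B B' : Fin k → Matrix (Fin d) (Fin d) ℂ) : Prop :=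
  ∀ i l, B i * B' l + B l * B' i = if i = l then (2 : ℂ) • 1 else 0

theorem sum_comm_half {M : Type*} [AddCommGroup M] (f : Fin k → Fin k → M) :
    ∑ i, ∑ l, f i l + ∑ i, ∑ l, f i l = ∑ i, ∑ l, (f i l + f l i) := by
  simp only [Finset.sum_add_distrib]
  rw [Finset.sum_comm (f := fun i l => f l i)]

theorem IsCliffordPair.symb_symb {B B' : Fin k → Matrix (Fin d) (Fin d) ℂ}
    (h : IsCliffordPair B B') (p : VPoly k d) :
    symb B (symb B' p) = (∑ i, (X i : MvPolynomial (Fin k) ℂ) ^ 2) • p := by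
  have h2 : (2 : ℂ) • symb B (symb B' p) =
      (2 : ℂ) • ((∑ i, (X i : MvPolynomial (Fin k) ℂ) ^ 2) • p) := by
    rw [two_smul]
    simp only [symb_apply, map_sum, map_smul, act_act, Finset.smul_sum, smul_smul]
    rw [sum_comm_half]
    have : ∀ i l : Fin k, ((X i * X l : MvPolynomial (Fin k) ℂ) • act (B l * B' i) p +
        (X l * X i : MvPolynomial (Fin k) ℂ) • act (B i * B' l) p) =
        if i = l then (2 : ℂ) • (X i ^ 2 : MvPolynomial (Fin k) ℂ) • p else 0 := by
      intro i l
      rw [mul_comm (X l), ← smul_add, ← act_add, add_comm, h i l]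
      split_ifs with hil
      · subst hil
        rw [act_smul, act_one, smul_comm, sq]
      · simp [act]
    simp only [this, Finset.sum_ite_eq, Finset.mem_univ, if_true, Finset.sum_smul,
      Finset.smul_sum]
  exact smul_right_injective _ (two_ne_zero (α := ℂ)) h2

theorem sum_X_sq_ne_zero (hk : 0 < k) :
    (∑ i, (X i : MvPolynomial (Fin k) ℂ) ^ 2) ≠ 0 := by
  intro h
  have := congrArg (eval fun _ => (1 : ℂ)) h
  simp at this
  omega

theorem IsCliffordPair.symb_eq_zero (hk : 0 < k) {B B' : Fin k → Matrix (Fin d) (Fin d) ℂ}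
    (h : IsCliffordPair B B') {p : VPoly k d} (hp : symb B' p = 0) : p = 0 := by
  have := h.symb_symb p
  rw [hp, map_zero] at this
  exact (smul_eq_zero.1 this.symm).resolve_left (sum_X_sq_ne_zero hk)

theorem IsCliffordPair.dirac_symb {m : ℕ} {B B' : Fin k → Matrix (Fin d) (Fin d) ℂ}
    (h : IsCliffordPair B B') {q : VPoly k d} (hq : q ∈ PmSub k d m) :
    dirac B (symb B' q) = ((2 * m + k : ℕ) : ℂ) • q - symb B (dirac B' q) := by
  have hdiag : ∀ i, B i * B' i = 1 := by
    intro i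
    have := h i i
    rw [if_pos rfl, ← two_smul ℂ] at this
    exact smul_right_injective _ (two_ne_zero (α := ℂ)) this
  have h1 : dirac B (symb B' q) = (k : ℂ) • q +
      ∑ i, ∑ l, (X l : MvPolynomial (Fin k) ℂ) • act (B i * B' l) (pd i q) := by
    have hterm : ∀ i l : Fin k,
        act (B i) (pd i ((X l : MvPolynomial (Fin k) ℂ) • act (B' l) q)) =
        (if i = l then q else 0) +
          (X l : MvPolynomial (Fin k) ℂ) • act (B i * B' l) (pd i q) := by
      intro i l
      rw [pd_X_smul, map_add, map_smul, pd_act, act_act]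
      congr 1
      split_ifs with hil
      · subst hil; rw [act_act, hdiag, act_one]
      · rw [map_zero]
    rw [dirac_apply, symb_apply]
    simp only [map_sum, hterm, Finset.sum_add_distrib, Finset.sum_ite_eq, Finset.mem_univ,
      if_true, Finset.sum_const, Finset.card_univ, Fintype.card_fin, Nat.cast_smul_eq_nsmul]
  have h2 : symb B (dirac B' q) =
      ∑ i, ∑ l, (X l : MvPolynomial (Fin k) ℂ) • act (B l * B' i) (pd i q) := by
    simp only [dirac_apply, symb_apply, map_sum, act_act]
  rw [eq_sub_iff_add_eq, h1, h2, add_assoc]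
  simp only [← Finset.sum_add_distrib, ← smul_add, ← act_add, h _ _]
  have : ∀ i l : Fin k, (X l : MvPolynomial (Fin k) ℂ) •
      act (if i = l then (2 : ℂ) • 1 else 0 : Matrix (Fin d) (Fin d) ℂ) (pd i q) =
      if i = l then (2 : ℂ) • (X i : MvPolynomial (Fin k) ℂ) • pd i q else 0 := by
    intro i l
    split_ifs with hil
    · subst hil; rw [act_smul, act_one, smul_comm]
    · simp [act]
  simp only [this, Finset.sum_ite_eq, Finset.mem_univ, if_true, ← Finset.smul_sum,
    euler_apply hq, smul_smul, ← add_smul]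
  push_cast
  rw [add_comm]

theorem isCliffordPair_of_unitary {A : Fin k → Matrix (Fin d) (Fin d) ℂ}
    (hunit : ∀ θ : Fin k → ℝ, (∑ j, θ j ^ 2) = 1 →
      (∑ j, (θ j : ℂ) • A j) ∈ Matrix.unitaryGroup (Fin d) ℂ) :
    IsCliffordPair A (fun i => (A i)ᴴ) := by
  have hdiag : ∀ i, A i * (A i)ᴴ = 1 := by
    intro i
    have := Matrix.mem_unitaryGroup_iff.1 (hunit (Pi.single i 1) (by simp [Pi.single_apply]))
    simpa [Pi.single_apply, ite_smul, Matrix.star_eq_conjTranspose] using this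
  intro i l
  split_ifs with hil
  · subst hil; simp only [hdiag, two_smul]
  · have hθ : ∑ j, (Pi.single i (3 / 5) + Pi.single l (4 / 5) : Fin k → ℝ) j ^ 2 = 1 := by
      have : ∀ j, (Pi.single i (3 / 5) + Pi.single l (4 / 5) : Fin k → ℝ) j ^ 2 =
          (if j = i then 9 / 25 else 0) + (if j = l then 16 / 25 else 0) := by
        intro j
        by_cases h1 : j = i
        · subst h1; simp [hil]; norm_num
        · by_cases h2 : j = l
          · subst h2; simp [h1]; norm_num
          · simp [h1, h2]
      simp only [this, Finset.sum_add_distrib, Finset.sum_ite_eq', Finset.mem_univ, if_true]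
      norm_num
    have hsum : ∑ j, (((Pi.single i (3 / 5) + Pi.single l (4 / 5) : Fin k → ℝ) j : ℝ) : ℂ) • A j
        = (3 / 5 : ℂ) • A i + (4 / 5 : ℂ) • A l := by
      simp [Pi.single_apply, add_smul, Finset.sum_add_distrib, apply_ite Complex.ofReal,
        ite_smul]
    have := Matrix.mem_unitaryGroup_iff.1 (hunit _ hθ)
    rw [hsum, Matrix.star_eq_conjTranspose] at this
    simp only [Matrix.conjTranspose_add, Matrix.conjTranspose_smul, add_mul, mul_add,
      smul_mul_smul_comm, hdiag] at this
    have h3 : star (3 / 5 : ℂ) = 3 / 5 := by simp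
    have h4 : star (4 / 5 : ℂ) = 4 / 5 := by simp
    rw [h3, h4] at this
    have h5 : (12 / 25 : ℂ) • (A i * (A l)ᴴ + A l * (A i)ᴴ) = 0 := by
      have e : (1 : Matrix (Fin d) (Fin d) ℂ) = (9 / 25 : ℂ) • 1 + (16 / 25 : ℂ) • 1 := by
        rw [← add_smul]; norm_num
      rw [← sub_eq_zero] at this
      rw [← this]
      nth_rewrite 3 [e]
      module
    exact (smul_eq_zero.1 h5).resolve_left (by norm_num)


/-- The vector-valued monomial `x^α v`. -/
def vmonomial (α : Fin k →₀ ℕ) (v : Fin d → ℂ) : VPoly k d := fun r => monomial α (v r)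

theorem vmonomial_mem_PmSub {m : ℕ} {α : Fin k →₀ ℕ} (hα : α.degree = m) (v : Fin d → ℂ) :
    vmonomial α v ∈ PmSub k d m :=
  mem_PmSub.2 fun r => isHomogeneous_monomial (v r) hα

theorem act_pd_vmonomial (B : Matrix (Fin d) (Fin d) ℂ) (i : Fin k) (α : Fin k →₀ ℕ)
    (v : Fin d → ℂ) :
    act B (pd i (vmonomial α v)) =
      vmonomial (α - Finsupp.single i 1) ((α i : ℂ) • B *ᵥ v) := by
  ext1 r
  simp only [act_apply, pd_apply, vmonomial, pderiv_monomial, smul_monomial, ← map_sum]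
  congr 1
  simp only [Pi.smul_apply, Matrix.mulVec, dotProduct, smul_eq_mul, Finset.mul_sum]
  exact Finset.sum_congr rfl fun s _ => by ring

theorem sum_vmonomial (q : VPoly k d) :
    ∑ α ∈ Finset.univ.biUnion (fun r => (q r).support),
      vmonomial α (fun r => coeff α (q r)) = q := by
  ext r β
  simp only [Finset.sum_apply, vmonomial, coeff_sum, coeff_monomial, Finset.sum_ite_eq']
  split_ifs with h
  · rfl
  · have : β ∉ (q r).support := fun hβ => h (Finset.mem_biUnion.2 ⟨r, Finset.mem_univ r, hβ⟩)
    exact (notMem_support_iff.1 this).symm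

theorem vmonomial_mem_map_dirac {B : Fin k → Matrix (Fin d) (Fin d) ℂ} {i₀ : Fin k}
    (hB : IsUnit (B i₀)) {m : ℕ} (n : ℕ) (α : Fin k →₀ ℕ) (v : Fin d → ℂ)
    (hα : α.degree = m) (hn : m - α i₀ = n) :
    vmonomial α v ∈ (PmSub k d (m + 1)).map (dirac B) := by
  induction n using Nat.strong_induction_on generalizing α v with
  | _ n ih =>
    set w : Fin d → ℂ := ((α i₀ : ℂ) + 1)⁻¹ • (B i₀)⁻¹ *ᵥ v with hw
    set β : Fin k →₀ ℕ := α + Finsupp.single i₀ 1 with hβ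
    have hβdeg : β.degree = m + 1 := by simp [hβ, hα]
    have hβ₀ : β i₀ = α i₀ + 1 := by simp [hβ]
    have hmain : act (B i₀) (pd i₀ (vmonomial β w)) = vmonomial α v := by
      have hdet := (Matrix.isUnit_iff_isUnit_det _).1 hB
      have hne : (α i₀ : ℂ) + 1 ≠ 0 := Nat.cast_add_one_ne_zero _
      rw [act_pd_vmonomial, hβ₀, hw, Matrix.mulVec_smul, Matrix.mulVec_mulVec,
        Matrix.mul_nonsing_inv _ hdet, Matrix.one_mulVec, smul_smul, Nat.cast_add, Nat.cast_one,
        mul_inv_cancel₀ hne, one_smul, hβ, add_tsub_cancel_right]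
    have hsum := dirac_apply B (vmonomial β w)
    rw [← Finset.add_sum_erase _ _ (Finset.mem_univ i₀), hmain, ← sub_eq_iff_eq_add] at hsum
    rw [← hsum]
    refine Submodule.sub_mem _ (Submodule.mem_map_of_mem (vmonomial_mem_PmSub hβdeg w))
      (Submodule.sum_mem _ fun i hi => ?_)
    have hi₀ : i ≠ i₀ := Finset.ne_of_mem_erase hi
    rw [act_pd_vmonomial]
    by_cases hzero : β i = 0
    · have : vmonomial (β - Finsupp.single i 1) ((β i : ℂ) • B i *ᵥ w) = (0 : VPoly k d) := by
        ext1 r; simp [vmonomial, hzero]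
      rw [this]
      exact Submodule.zero_mem _
    · have hle : Finsupp.single i 1 ≤ β := Finsupp.single_le_iff.2 (Nat.one_le_iff_ne_zero.2 hzero)
      have hdeg : (β - Finsupp.single i 1).degree = m := by
        have := congrArg Finsupp.degree (tsub_add_cancel_of_le hle)
        rw [map_add, Finsupp.degree_single, hβdeg] at this
        omega
      have hval : (β - Finsupp.single i 1 : Fin k →₀ ℕ) i₀ = α i₀ + 1 := by
        simp [hβ₀, hi₀]
      have hlt : α i₀ + 1 ≤ m := by
        rw [← hval, ← hdeg]
        exact Finsupp.le_degree _ _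
      exact ih (m - (α i₀ + 1)) (by omega) _ _ hdeg (by rw [hval])

theorem map_dirac_PmSub {B : Fin k → Matrix (Fin d) (Fin d) ℂ} {i₀ : Fin k}
    (hB : IsUnit (B i₀)) (m : ℕ) :
    (PmSub k d (m + 1)).map (dirac B) = PmSub k d m := by
  apply le_antisymm
  · rintro _ ⟨p, hp, rfl⟩
    exact dirac_mem_PmSub B hp
  · intro q hq
    rw [← sum_vmonomial q]
    refine Submodule.sum_mem _ fun α hα => ?_
    obtain ⟨r, -, hr⟩ := Finset.mem_biUnion.1 hα
    refine vmonomial_mem_map_dirac hB _ α _ ?_ rfl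
    rw [Finsupp.degree_eq_weight_one]
    exact mem_PmSub.1 hq r (mem_support_iff.1 hr)

theorem finrank_ker_dirac_succ {B : Fin k → Matrix (Fin d) (Fin d) ℂ} {i₀ : Fin k}
    (hB : IsUnit (B i₀)) (m : ℕ) :
    Module.finrank ℂ (PmSub k d m) +
      Module.finrank ℂ ↥(PmSub k d (m + 1) ⊓ LinearMap.ker (dirac B)) =
      Module.finrank ℂ (PmSub k d (m + 1)) := by
  have h := LinearMap.finrank_range_add_finrank_ker ((dirac B).domRestrict (PmSub k d (m + 1)))
  rwa [LinearMap.range_domRestrict, map_dirac_PmSub hB, LinearMap.ker_domRestrict,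
    ← Submodule.finrank_map_subtype_eq, Submodule.map_comap_subtype] at h

theorem finrank_ker_dirac (hk : 2 ≤ k) {B : Fin k → Matrix (Fin d) (Fin d) ℂ} {i₀ : Fin k}
    (hB : IsUnit (B i₀)) (m : ℕ) :
    Module.finrank ℂ ↥(PmSub k d m ⊓ LinearMap.ker (dirac B)) = d * (m + k - 2).choose m := by
  cases m with
  | zero =>
    have : PmSub k d 0 ≤ LinearMap.ker (dirac B) := by
      intro p hp
      rw [LinearMap.mem_ker, dirac_apply]
      refine Finset.sum_eq_zero fun i _ => ?_
      have : pd i p = 0 := by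
        ext1 r
        have h := (totalDegree_eq_zero_iff_eq_C (p := p r)).1
          (Nat.le_zero.1 (mem_PmSub.1 hp r).totalDegree_le)
        rw [pd_apply, h, pderiv_C, Pi.zero_apply]
      rw [this, map_zero]
    rw [inf_eq_left.2 this, finrank_PmSub]
    simp
  | succ m =>
    have h := finrank_ker_dirac_succ hB m
    obtain ⟨k, rfl⟩ := Nat.exists_eq_add_of_le' hk
    rw [finrank_PmSub, finrank_PmSub, show k + 2 + (m + 1) - 1 = (k + m + 1) + 1 by omega,
      show k + 2 + m - 1 = k + m + 1 by omega, Nat.choose_succ_succ, mul_add] at h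
    rw [show m + 1 + (k + 2) - 2 = k + m + 1 by omega]
    exact Nat.add_left_cancel h

theorem eigenSub_neg (hk : 0 < k) {A : Fin k → Matrix (Fin d) (Fin d) ℂ}
    (h : IsCliffordPair A (fun i => (A i)ᴴ)) (m : ℕ) :
    eigenSub A m (-(m : ℂ)) = PmSub k d m ⊓ LinearMap.ker (dirac A) := by
  ext p
  refine and_congr_right fun hp => ?_
  have hLp : (LOp A - (-(m : ℂ)) • (LinearMap.id : VPoly k d →ₗ[ℂ] VPoly k d)) p =
      symb (fun i => (A i)ᴴ) (dirac A p) := by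
    rw [LinearMap.sub_apply, LOp_apply A hp, LinearMap.smul_apply, LinearMap.id_apply]
    module
  simp only [SetLike.mem_coe, LinearMap.mem_ker]
  rw [hLp]
  exact ⟨h.symb_eq_zero hk, fun h0 => by rw [h0, map_zero]⟩

theorem map_symb_ker_dirac (hk : 0 < k) {A : Fin k → Matrix (Fin d) (Fin d) ℂ}
    (h : IsCliffordPair A (fun i => (A i)ᴴ)) (h' : IsCliffordPair (fun i => (A i)ᴴ) A)
    (m : ℕ) :
    (PmSub k d m ⊓ LinearMap.ker (dirac fun i => (A i)ᴴ)).map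
        ((symb fun i => (A i)ᴴ).restrictScalars ℂ) =
      eigenSub A (m + 1) ((m : ℂ) + k - 1) := by
  have hL : ∀ p ∈ PmSub k d (m + 1), (LOp A - ((m : ℂ) + k - 1) •
      (LinearMap.id : VPoly k d →ₗ[ℂ] VPoly k d)) p =
      symb (fun i => (A i)ᴴ) (dirac A p) - ((2 * m + k : ℕ) : ℂ) • p := by
    intro p hp
    rw [LinearMap.sub_apply, LOp_apply A hp, LinearMap.smul_apply, LinearMap.id_apply]
    push_cast
    module
  have hne : ((2 * m + k : ℕ) : ℂ) ≠ 0 := Nat.cast_ne_zero.2 (by omega)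
  apply le_antisymm
  · rintro _ ⟨q, ⟨hq, hq0⟩, rfl⟩
    have hSq := symb_mem_PmSub (fun i => (A i)ᴴ) hq
    refine ⟨hSq, ?_⟩
    simp only [SetLike.mem_coe, LinearMap.mem_ker, LinearMap.restrictScalars_apply] at hq0 ⊢
    rw [hL _ hSq, h.dirac_symb hq, hq0, map_zero, sub_zero,
      LinearMap.map_smul_of_tower, sub_self]
  · rintro p ⟨hp, hp0⟩
    simp only [SetLike.mem_coe, LinearMap.mem_ker] at hp0
    rw [hL p hp, sub_eq_zero] at hp0
    have hDp : dirac A p ∈ PmSub k d m := dirac_mem_PmSub A hp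
    have hker : dirac (fun i => (A i)ᴴ) (dirac A p) = 0 := by
      have e := h.dirac_symb hDp
      rw [hp0, map_smul, eq_comm, sub_eq_self] at e
      exact h'.symb_eq_zero hk e
    refine ⟨((2 * m + k : ℕ) : ℂ)⁻¹ • dirac A p,
      Submodule.smul_mem _ _ ⟨hDp, hker⟩, ?_⟩
    rw [LinearMap.map_smul, LinearMap.restrictScalars_apply, hp0, smul_smul,
      inv_mul_cancel₀ hne, one_smul]

end VPoly

/-- For every `j ≥ 0`, the eigenspace of `L` for the eigenvalue `−j` on `P_j`
and the eigenspace of `L` for the eigenvalue `j+k−1` on `P_{j+1}` have the same dimension,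
namely `d·binom(j+k−2, j)`. -/
theorem dim_extreme_eigenspaces (k d : ℕ) (hk : 2 ≤ k) (hd : 1 ≤ d)
    (A : Fin k → Matrix (Fin d) (Fin d) ℂ)
    (hinv : ∀ j, IsUnit (A j))
    (hell : elliptic A)
    (hunit : ∀ θ : Fin k → ℝ, (∑ j, θ j ^ 2) = 1 →
      (∑ j, (θ j : ℂ) • A j) ∈ Matrix.unitaryGroup (Fin d) ℂ)
    (j : ℕ) :
    Module.finrank ℂ (eigenSub A j (-(j : ℂ)))
        = Module.finrank ℂ (eigenSub A (j + 1) ((j : ℂ) + k - 1)) ∧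
    Module.finrank ℂ (eigenSub A j (-(j : ℂ))) = d * Nat.choose (j + k - 2) j := by
  have hk0 : 0 < k := by omega
  have h := VPoly.isCliffordPair_of_unitary hunit
  have h' : VPoly.IsCliffordPair (fun i => (A i)ᴴ) A := by
    have hstar : ∀ θ : Fin k → ℝ, (∑ j, θ j ^ 2) = 1 →
        (∑ j, (θ j : ℂ) • (A j)ᴴ) ∈ Matrix.unitaryGroup (Fin d) ℂ := by
      intro θ hθ
      have := Unitary.star_mem (hunit θ hθ)
      simpa [Matrix.star_eq_conjTranspose, Matrix.conjTranspose_sum] using this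
    simpa using VPoly.isCliffordPair_of_unitary hstar
  have hdim := VPoly.finrank_ker_dirac hk (hinv ⟨0, hk0⟩) j
  have hstar_unit : IsUnit (A ⟨0, hk0⟩)ᴴ := (hinv ⟨0, hk0⟩).star
  have hdim' := VPoly.finrank_ker_dirac hk (B := fun i => (A i)ᴴ) hstar_unit j
  have hinj : Function.Injective
      ((VPoly.symb fun i => (A i)ᴴ).restrictScalars ℂ : VPoly k d →ₗ[ℂ] VPoly k d) :=
    (injective_iff_map_eq_zero _).2 fun p hp => h.symb_eq_zero hk0 hp
  rw [VPoly.eigenSub_neg hk0 h, ← VPoly.map_symb_ker_dirac hk0 h h' j,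
    ← (Submodule.equivMapOfInjective _ hinj _).finrank_eq, hdim, hdim']
  exact ⟨rfl, rfl⟩

end
end
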